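/- arXiv:2402.08541 — 6 statements merged into one kernel-verified Lean document; each statement's English description precedes it below -/
import Mathlib

section
/- Let c : ℝ → ℝ be twice differentiable with c(0) = 0, c'(z) > 0 for all z > 0, and c''(z) ≥ 0 for all z ≥ 0, and let s > 0. Then the function z ↦ z/(z+s) − c(z) attains a maximum on [0, ∞) at a unique point. -/
/-- The contest success function `z ↦ z / (z + s)` is strictly concave on `[0, ∞)`. -/
theorem strictConcaveOn_div_add_const {s : ℝ} (hs : 0 < s) :
    StrictConcaveOn ℝ (Set.Ici 0) fun z : ℝ => z / (z + s) := by
  refine ⟨convex_Ici 0, fun x hx y hy hxy a b ha hb hab => ?_⟩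
  simp only [Set.mem_Ici] at hx hy
  simp only [smul_eq_mul]
  have hX : 0 < x + s := by linarith
  have hY : 0 < y + s := by linarith
  have hZ : 0 < a * x + b * y + s := by positivity
  obtain rfl : b = 1 - a := by linarith
  have key : (a * x + (1 - a) * y) / (a * x + (1 - a) * y + s)
      - (a * (x / (x + s)) + (1 - a) * (y / (y + s)))
      = s * a * (1 - a) * (x - y) ^ 2 /
        ((x + s) * (y + s) * (a * x + (1 - a) * y + s)) := by
    field_simp
    ring
  have hsq : 0 < (x - y) ^ 2 := sq_pos_of_ne_zero (sub_ne_zero.mpr hxy)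
  have hpos : 0 < s * a * (1 - a) * (x - y) ^ 2 /
      ((x + s) * (y + s) * (a * x + (1 - a) * y + s)) := by positivity
  linarith

/-- A convex function on `[0, ∞)` vanishing at `0` dominates, beyond `1`, the line through the
origin and `(1, c 1)`. -/
theorem ConvexOn.mul_le_of_one_le {c : ℝ → ℝ} (hc : ConvexOn ℝ (Set.Ici 0) c) (hc0 : c 0 = 0)
    {z : ℝ} (hz : 1 ≤ z) : z * c 1 ≤ c z := by
  have hz0 : 0 < z := by linarith
  have hinv : z⁻¹ ≤ 1 := inv_le_one_of_one_le₀ hz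
  have h := hc.2 (x := z) (y := 0) hz0.le (le_refl (0 : ℝ)) (inv_nonneg.mpr hz0.le)
    (sub_nonneg.mpr hinv) (by ring)
  simp only [smul_eq_mul, mul_zero, add_zero, hc0, inv_mul_cancel₀ hz0.ne'] at h
  calc z * c 1 ≤ z * (z⁻¹ * c z) := by gcongr
    _ = c z := mul_inv_cancel_left₀ hz0.ne' _

/-- In a Tullock contest with opponents' total output `s > 0` and a twice
differentiable, increasing, weakly convex cost function `c` with `c 0 = 0`,
the utility `z ↦ z/(z+s) − c(z)` attains its maximum on `[0, ∞)` at a unique point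
(the best response `BR(s)`). -/
theorem tullock_bestResponse_existsUnique (c : ℝ → ℝ) (s : ℝ) (hs : 0 < s)
    (hc : Differentiable ℝ c) (hc' : Differentiable ℝ (deriv c))
    (hc0 : c 0 = 0) (hcpos : ∀ z : ℝ, 0 < z → 0 < deriv c z)
    (hc'' : ∀ z : ℝ, 0 ≤ z → 0 ≤ deriv (deriv c) z) :
    ∃! y : ℝ, y ∈ Set.Ici (0 : ℝ) ∧
      ∀ z ∈ Set.Ici (0 : ℝ), z / (z + s) - c z ≤ y / (y + s) - c y := by
  have hconv : ConvexOn ℝ (Set.Ici 0) c := by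
    refine convexOn_of_deriv2_nonneg (convex_Ici 0) hc.continuous.continuousOn
      hc.differentiableOn hc'.differentiableOn fun z hz => ?_
    exact hc'' z (interior_subset hz)
  have hc1 : 0 < c 1 := by
    have hmono : StrictMonoOn c (Set.Ici 0) :=
      strictMonoOn_of_deriv_pos (convex_Ici 0) hc.continuous.continuousOn fun z hz =>
        hcpos z (by simpa using hz)
    simpa [hc0] using hmono (Set.mem_Ici.mpr le_rfl) (Set.mem_Ici.mpr zero_le_one) zero_lt_one
  have hconc : StrictConcaveOn ℝ (Set.Ici 0) fun z : ℝ => z / (z + s) - c z :=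
    (strictConcaveOn_div_add_const hs).sub_convexOn hconv
  have hcont : ContinuousOn (fun z : ℝ => z / (z + s) - c z) (Set.Ici 0) := by
    refine (continuousOn_id.div (by fun_prop) fun z hz => ?_).sub hc.continuous.continuousOn
    have hz0 : 0 ≤ z := hz
    positivity
  set M : ℝ := max 1 (c 1)⁻¹
  have hM : 0 ≤ M := zero_le_one.trans (le_max_left _ _)
  obtain ⟨y, hy, hmax⟩ := isCompact_Icc.exists_isMaxOn (Set.nonempty_Icc.mpr hM)
    (hcont.mono Set.Icc_subset_Ici_self)
  have hglobal : ∀ z ∈ Set.Ici (0 : ℝ), z / (z + s) - c z ≤ y / (y + s) - c y := by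
    intro z hz
    rcases le_total z M with hzM | hzM
    · exact hmax ⟨hz, hzM⟩
    · have hz0 : 0 ≤ z := hz
      have hone : 1 ≤ z * c 1 :=
        (inv_le_iff_one_le_mul₀ hc1).mp ((le_max_right _ _).trans hzM)
      have hle := hconv.mul_le_of_one_le hc0 ((le_max_left _ _).trans hzM)
      have hshare : z / (z + s) ≤ 1 := div_le_one_of_le₀ (by linarith) (by linarith)
      have hzero : 0 ≤ y / (y + s) - c y := by
        simpa [hc0] using hmax (Set.left_mem_Icc.mpr hM)
      linarith
  exact ⟨y, ⟨hy.1, hglobal⟩, fun w hw => hconc.eq_of_isMaxOn hw.2 hglobal hw.1 hy.1⟩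
end

section
/- Let c : ℝ → ℝ be twice differentiable with c''(z) ≥ 0 for all z ≥ 0, let I ⊆ (0, ∞) be an open interval, and let y : I → ℝ be differentiable with y(s) > 0 and s/(y(s)+s)² = c'(y(s)) for all s ∈ I. Then for all s ∈ I, y'(s) = (y(s) − s) / (2s + (y(s)+s)³ · c''(y(s))). -/
/-- Derivative of the interior best response in a Tullock contest: if on an open
interval `I ⊆ (0, ∞)` the differentiable function `y` satisfies `y s > 0` and the
first-order condition `s/(y s + s)² = c'(y s)`, then
`y'(s) = (y s − s) / (2s + (y s + s)³ · c''(y s))`. -/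
theorem tullock_bestResponse_deriv (c : ℝ → ℝ)
    (hc : Differentiable ℝ c) (hc' : Differentiable ℝ (deriv c))
    (hc'' : ∀ z : ℝ, 0 ≤ z → 0 ≤ deriv (deriv c) z)
    (I : Set ℝ) (hIopen : IsOpen I) (hIsub : I ⊆ Set.Ioi (0 : ℝ))
    (hIinterval : I.OrdConnected)
    (y : ℝ → ℝ) (hy : ∀ s ∈ I, DifferentiableAt ℝ y s)
    (hypos : ∀ s ∈ I, 0 < y s)
    (hfoc : ∀ s ∈ I, s / (y s + s) ^ 2 = deriv c (y s)) :
    ∀ s ∈ I, deriv y s = (y s - s) / (2 * s + (y s + s) ^ 3 * deriv (deriv c) (y s)) := by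
  intro s hs
  have hs0 : 0 < s := hIsub hs
  have hy0 := hypos s hs
  have hsum : 0 < y s + s := by positivity
  have hyd := (hy s hs).hasDerivAt
  have hleft := (hasDerivAt_id s).fun_div ((hyd.add (hasDerivAt_id s)).fun_pow 2)
    (pow_ne_zero 2 hsum.ne')
  have hright := (hc' (y s)).hasDerivAt.comp s hyd
  have heq : (fun t => id t / (y + id : ℝ → ℝ) t ^ 2) =ᶠ[nhds s] deriv c ∘ y := by
    filter_upwards [hIopen.mem_nhds hs] with t ht
    exact hfoc t ht
  have hderiv := hleft.unique (hright.congr_of_eventuallyEq heq)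
  have hcc := hc'' (y s) hy0.le
  have hden : 0 < 2 * s + (y s + s) ^ 3 * deriv (deriv c) (y s) := by positivity
  simp only [Pi.add_apply, id_eq] at hderiv
  rw [div_eq_iff (by positivity)] at hderiv
  rw [eq_div_iff hden.ne']
  apply mul_left_cancel₀ hsum.ne'
  norm_num at hderiv
  linear_combination -hderiv
end

section
/- Fix n ≥ 2 and, for each i ∈ {1,…,n}, a twice differentiable cost function cᵢ : ℝ → ℝ with cᵢ(0) = 0, cᵢ'(z) > 0 for z > 0, and cᵢ''(z) ≥ 0 for z ≥ 0. Let x : ℝ → ℝⁿ and y : ℝ → ℝⁿ be differentiable, and for each t and i write s₋ᵢ(t) = Σ_{j≠i} xⱼ(t) and σ(t) = Σⱼ yⱼ(t). Suppose for every t and every i: xᵢ(t) ≥ 0, s₋ᵢ(t) > 0, yᵢ(t) > 0, the first-order condition s₋ᵢ(t)/(yᵢ(t)+s₋ᵢ(t))² = cᵢ'(yᵢ(t)) holds, and xᵢ'(t) = yᵢ(t) − xᵢ(t). Define V(t) = Σᵢ [ (yᵢ(t)/(yᵢ(t)+s₋ᵢ(t)) − cᵢ(yᵢ(t))) − (xᵢ(t)/(xᵢ(t)+s₋ᵢ(t))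 − cᵢ(xᵢ(t))) ]. Then for every t, V'(t) + V(t) ≤ − Σᵢ (yᵢ(t)/σ(t)) · (1 − σ(t)/(yᵢ(t)+s₋ᵢ(t)))² ≤ 0. -/
open Finset

/-- Total output of the agents other than `i` at time `t`. -/
noncomputable def othersSum (n : ℕ) (x : ℝ → Fin n → ℝ) (t : ℝ) (i : Fin n) : ℝ :=
  ∑ j ∈ Finset.univ.erase i, x t j

/-- The total-regret Lyapunov potential of the continuous-time best-response dynamics:
the sum over agents of the utility gain from switching from the current action `x t i`
to the best response `y t i`. -/
noncomputable def potential (n : ℕ) (c : Fin n → ℝ → ℝ) (x y : ℝ → Fin n → ℝ) (t : ℝ) : ℝ :=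
  ∑ i, ((y t i / (y t i + othersSum n x t i) - c i (y t i)) -
    (x t i / (x t i + othersSum n x t i) - c i (x t i)))

/-- Tangent line inequality for a twice differentiable function on `[0, ∞)` with nonnegative
second derivative. -/
lemma add_deriv_mul_sub_le_of_deriv2_nonneg {f : ℝ → ℝ} (hf : Differentiable ℝ f)
    (hf' : Differentiable ℝ (deriv f)) (hf'' : ∀ z, 0 ≤ z → 0 ≤ deriv (deriv f) z)
    {a b : ℝ} (ha : 0 ≤ a) (hb : 0 ≤ b) : f a + deriv f a * (b - a) ≤ f b := by
  have hconv : ConvexOn ℝ (Set.Ici 0) f :=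
    convexOn_of_deriv2_nonneg' (convex_Ici 0) hf.differentiableOn hf'.differentiableOn
      fun z hz => hf'' z hz
  rcases lt_trichotomy a b with h | rfl | h
  · have := hconv.le_slope_of_hasDerivAt ha hb h (hf a).hasDerivAt
    rw [slope_def_field, le_div_iff₀ (sub_pos.2 h)] at this
    linarith
  · simp
  · have := hconv.slope_le_of_hasDerivAt hb ha h (hf a).hasDerivAt
    rw [slope_def_field, div_le_iff₀ (sub_pos.2 h)] at this
    linarith

lemma add_othersSum (n : ℕ) (x : ℝ → Fin n → ℝ) (t : ℝ) (i : Fin n) :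
    x t i + othersSum n x t i = ∑ j, x t j :=
  Finset.add_sum_erase _ _ (Finset.mem_univ i)

/-- The contest shares sum to one. -/
lemma sum_share_eq_one (n : ℕ) (x : ℝ → Fin n → ℝ) (t : ℝ) (h : ∑ j, x t j ≠ 0) :
    ∑ i, x t i / (x t i + othersSum n x t i) = 1 := by
  simp_rw [add_othersSum, ← Finset.sum_div]
  exact div_self h

lemma potential_eq_of_sum_ne_zero (n : ℕ) (c : Fin n → ℝ → ℝ) (x y : ℝ → Fin n → ℝ) (t : ℝ)
    (h : ∑ j, x t j ≠ 0) :
    potential n c x y t =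
      ∑ i, (y t i / (y t i + othersSum n x t i) - c i (y t i) + c i (x t i)) - 1 := by
  rw [← sum_share_eq_one n x t h, ← Finset.sum_sub_distrib]
  exact Finset.sum_congr rfl fun i _ => by ring

lemma hasDerivAt_othersSum {n : ℕ} {x : ℝ → Fin n → ℝ} {t : ℝ} {v : Fin n → ℝ}
    (hdx : ∀ i, HasDerivAt (fun t => x t i) (v i) t) (i : Fin n) :
    HasDerivAt (fun t => othersSum n x t i) (∑ j, v j - v i) t := by
  rw [← Finset.sum_erase_eq_sub (Finset.mem_univ i)]
  exact HasDerivAt.fun_sum fun j _ => hdx j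

/-- Envelope formula: at an interior optimum only the direct effect of the rivals' output remains. -/
lemma hasDerivAt_utility_of_first_order {f y s : ℝ → ℝ} {s' t : ℝ}
    (hf : DifferentiableAt ℝ f (y t)) (hy : DifferentiableAt ℝ y t) (hs : HasDerivAt s s' t)
    (hne : y t + s t ≠ 0) (hfoc : s t / (y t + s t) ^ 2 = deriv f (y t)) :
    HasDerivAt (fun t => y t / (y t + s t) - f (y t)) (-(y t / (y t + s t) ^ 2 * s')) t := by
  have hd := (hy.hasDerivAt.fun_div (hy.hasDerivAt.fun_add hs) hne).fun_sub
    (hf.hasDerivAt.comp t hy.hasDerivAt)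
  refine hd.congr_deriv ?_
  rw [← hfoc]
  field_simp
  ring

/-- Lemma 1 of the paper: along the continuous-time best-response dynamics
`xᵢ' = yᵢ − xᵢ` in a Tullock contest with twice differentiable, increasing, weakly
convex costs (with the best responses `yᵢ` interior, satisfying the first-order
conditions), the total-regret potential `V` satisfies
`V'(t) + V(t) ≤ −Σᵢ (yᵢ/σ)·(1 − σ/(yᵢ + s₋ᵢ))² ≤ 0`, where `σ = Σⱼ yⱼ`. -/
theorem tullock_potential_decreases (n : ℕ) (hn : 2 ≤ n) (c : Fin n → ℝ → ℝ)
    (hc : ∀ i, Differentiable ℝ (c i)) (hc' : ∀ i, Differentiable ℝ (deriv (c i)))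
    (hc0 : ∀ i, c i 0 = 0) (hcpos : ∀ i, ∀ z : ℝ, 0 < z → 0 < deriv (c i) z)
    (hc'' : ∀ i, ∀ z : ℝ, 0 ≤ z → 0 ≤ deriv (deriv (c i)) z)
    (x y : ℝ → Fin n → ℝ)
    (hx : ∀ i, Differentiable ℝ fun t => x t i)
    (hy : ∀ i, Differentiable ℝ fun t => y t i)
    (hxnn : ∀ t i, 0 ≤ x t i)
    (hspos : ∀ t i, 0 < othersSum n x t i)
    (hypos : ∀ t i, 0 < y t i)
    (hfoc : ∀ t i, othersSum n x t i / (y t i + othersSum n x t i) ^ 2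
      = deriv (c i) (y t i))
    (hdx : ∀ t i, HasDerivAt (fun t => x t i) (y t i - x t i) t) :
    ∀ t : ℝ,
      deriv (potential n c x y) t + potential n c x y t ≤
        -∑ i, (y t i / ∑ j, y t j) * (1 - (∑ j, y t j) / (y t i + othersSum n x t i)) ^ 2 ∧
      -∑ i, (y t i / ∑ j, y t j) * (1 - (∑ j, y t j) / (y t i + othersSum n x t i)) ^ 2 ≤ 0 := by
  intro t
  have hσ : 0 < ∑ j, y t j :=
    Finset.sum_pos (fun j _ => hypos t j) ⟨⟨0, by omega⟩, Finset.mem_univ _⟩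
  refine ⟨?_, neg_nonpos.2 <| Finset.sum_nonneg fun i _ =>
    mul_nonneg (div_nonneg (hypos t i).le hσ.le) (sq_nonneg _)⟩
  have hX (u : ℝ) : ∑ j, x u j ≠ 0 := by
    rw [← add_othersSum n x u ⟨0, by omega⟩]
    exact (add_pos_of_nonneg_of_pos (hxnn u _) (hspos u _)).ne'
  have hp (i : Fin n) : 0 < y t i + othersSum n x t i := add_pos (hypos t i) (hspos t i)
  have hs (i : Fin n) : HasDerivAt (fun t => othersSum n x t i)
      (∑ j, y t j - y t i - othersSum n x t i) t := by
    refine (hasDerivAt_othersSum (hdx t) i).congr_deriv ?_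
    rw [Finset.sum_sub_distrib, ← add_othersSum n x t i]
    ring
  have hV : HasDerivAt (potential n c x y)
      (∑ i, (-(y t i / (y t i + othersSum n x t i) ^ 2 *
        (∑ j, y t j - y t i - othersSum n x t i)) + deriv (c i) (x t i) * (y t i - x t i))) t := by
    rw [funext fun u => potential_eq_of_sum_ne_zero n c x y u (hX u)]
    exact (HasDerivAt.fun_sum fun i _ =>
      (hasDerivAt_utility_of_first_order (hc i _) (hy i t) (hs i) (hp i).ne' (hfoc t i)).fun_add
        ((hc i _).hasDerivAt.comp t (hdx t i))).sub_const 1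
  have hone : ∑ i, y t i / ∑ j, y t j = 1 := by
    rw [← Finset.sum_div, div_self hσ.ne']
  have hpot : potential n c x y t = ∑ i, (y t i / (y t i + othersSum n x t i) - c i (y t i) +
      c i (x t i) - y t i / ∑ j, y t j) := by
    rw [potential_eq_of_sum_ne_zero n c x y t (hX t), Finset.sum_sub_distrib, hone]
  rw [hV.deriv, hpot, ← Finset.sum_add_distrib, ← Finset.sum_neg_distrib]
  refine Finset.sum_le_sum fun i _ => ?_
  have htan := add_deriv_mul_sub_le_of_deriv2_nonneg (hc i) (hc' i) (hc'' i) (hxnn t i)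
    (hypos t i).le
  have hsquare : -(y t i / (y t i + othersSum n x t i) ^ 2 *
        (∑ j, y t j - y t i - othersSum n x t i)) + y t i / (y t i + othersSum n x t i)
        - y t i / ∑ j, y t j =
      -((y t i / ∑ j, y t j) * (1 - (∑ j, y t j) / (y t i + othersSum n x t i)) ^ 2) := by
    have := (hp i).ne'
    have := hσ.ne'
    field_simp
    ring
  linarith
end

section
/- Let y : [0, ∞) → ℝ be differentiable with y(t) > 0 for all t ≥ 0 and y'(t) = 2·(√(y(t)) − y(t)) for all t ≥ 0. Then for all t ≥ 0, (√(y(t)) − 1)² = (√(y(0)) − 1)² · e^{−2t}. -/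
/-- The square root linearises `y' = 2(√y − y)`: if `y` is positive at `t`, then `(√y − 1) eᵗ` has
zero derivative there. -/
lemma hasDerivWithinAt_sqrt_sub_one_mul_exp {y : ℝ → ℝ} {s : Set ℝ} {t : ℝ} (hpos : 0 < y t)
    (hder : HasDerivWithinAt y (2 * (Real.sqrt (y t) - y t)) s t) :
    HasDerivWithinAt (fun t => (Real.sqrt (y t) - 1) * Real.exp t) 0 s t := by
  have hsqrt : Real.sqrt (y t) ≠ 0 := (Real.sqrt_pos.2 hpos).ne'
  have hsq : Real.sqrt (y t) ^ 2 = y t := Real.sq_sqrt hpos.le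
  refine (((hder.sqrt hpos.ne').sub_const 1).mul
    (Real.hasDerivAt_exp t).hasDerivWithinAt).congr_deriv ?_
  field_simp
  linear_combination Real.exp t * hsq

/-- Exact exponential decay of the potential in the symmetric two-player lower-bound
example: if `y : [0,∞) → ℝ` is positive and satisfies `y' = 2(√y − y)`, then
`(√(y t) − 1)² = (√(y 0) − 1)² · e^{−2t}` for all `t ≥ 0`. -/
theorem tullock_lower_bound_potential_decay (y : ℝ → ℝ)
    (hpos : ∀ t : ℝ, 0 ≤ t → 0 < y t)
    (hder : ∀ t : ℝ, 0 ≤ t →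
      HasDerivWithinAt y (2 * (Real.sqrt (y t) - y t)) (Set.Ici 0) t) :
    ∀ t : ℝ, 0 ≤ t →
      (Real.sqrt (y t) - 1) ^ 2 = (Real.sqrt (y 0) - 1) ^ 2 * Real.exp (-2 * t) := by
  intro t ht
  have hderiv (x : ℝ) (hx : 0 ≤ x) :=
    hasDerivWithinAt_sqrt_sub_one_mul_exp (hpos x hx) (hder x hx)
  have hconst : (Real.sqrt (y t) - 1) * Real.exp t = Real.sqrt (y 0) - 1 := by
    simpa using constant_of_has_deriv_right_zero
      (fun x hx => (hderiv x hx.1).continuousWithinAt.mono Set.Icc_subset_Ici_self)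
      (fun x hx => (hderiv x hx.1).mono (Set.Ici_subset_Ici.2 hx.1)) t (Set.right_mem_Icc.2 ht)
  have hexp : Real.exp t ^ 2 * Real.exp (-2 * t) = 1 := by
    rw [← Real.exp_nat_mul, ← Real.exp_add]
    simp
  rw [← hconst, mul_pow, mul_assoc, hexp, mul_one]
end

section
/- Let n ≥ 2, let 0 < x_min ≤ 1/n, let B₂ ≥ 0, and let x, y : {1,…,n} → ℝ with x_min ≤ xᵢ ≤ 1 and x_min ≤ yᵢ ≤ 1 for all i. Write s₋ᵢ = Σ_{j≠i} xⱼ and σ = Σⱼ yⱼ. Then (B₂/2)·Σᵢ (yᵢ−xᵢ)² + Σᵢ (σ − yᵢ − s₋ᵢ)²/s₋ᵢ² ≤ ( B₂·n³/(2·x_min) + n³/((n−1)²·x_min³) ) · Σᵢ yᵢ·(σ − yᵢ − s₋ᵢ)² / (σ·(yᵢ+s₋ᵢ)²). -/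
open Finset

/-- The squared norm of `d` is at most that of the vector of its leave-one-out sums. -/
theorem sum_sq_le_sum_sum_sub_sq {n : ℕ} (hn : 2 ≤ n) (d : Fin n → ℝ) :
    ∑ i, d i ^ 2 ≤ ∑ i, ((∑ j, d j) - d i) ^ 2 := by
  have hn' : (2 : ℝ) ≤ n := by exact_mod_cast hn
  have expand : ∑ i, ((∑ j, d j) - d i) ^ 2 =
      ((n : ℝ) - 2) * (∑ j, d j) ^ 2 + ∑ i, d i ^ 2 := by
    simp only [sub_sq, Finset.sum_add_distrib, Finset.sum_sub_distrib, ← Finset.mul_sum,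
      Finset.sum_const, Finset.card_univ, Fintype.card_fin, nsmul_eq_mul]
    ring
  rw [expand]
  have := mul_nonneg (sub_nonneg.2 hn') (sq_nonneg (∑ j, d j))
  linarith

/-- Core of the bound `H(x) = O(n(1+B₂)/x_min³)` on the step-size function for
discrete-time best-response dynamics in a Tullock contest with actions restricted to
`[x_min, 1]`: writing `s₋ᵢ = Σ_{j≠i} xⱼ` and `σ = Σⱼ yⱼ`,
`(B₂/2)·Σᵢ(yᵢ−xᵢ)² + Σᵢ(σ−yᵢ−s₋ᵢ)²/s₋ᵢ²
  ≤ (B₂n³/(2x_min) + n³/((n−1)²x_min³)) · Σᵢ yᵢ(σ−yᵢ−s₋ᵢ)²/(σ(yᵢ+s₋ᵢ)²)`. -/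
theorem stepsize_function_bound (n : ℕ) (hn : 2 ≤ n) (xmin B2 : ℝ)
    (hxmin : 0 < xmin) (hxmin' : xmin ≤ 1 / n) (hB2 : 0 ≤ B2)
    (x y : Fin n → ℝ)
    (hx : ∀ i, xmin ≤ x i ∧ x i ≤ 1) (hy : ∀ i, xmin ≤ y i ∧ y i ≤ 1) :
    B2 / 2 * (∑ i, (y i - x i) ^ 2) +
        ∑ i, ((∑ j, y j) - y i - ∑ j ∈ Finset.univ.erase i, x j) ^ 2
          / (∑ j ∈ Finset.univ.erase i, x j) ^ 2
      ≤ (B2 * (n : ℝ) ^ 3 / (2 * xmin) + (n : ℝ) ^ 3 / (((n : ℝ) - 1) ^ 2 * xmin ^ 3)) *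
          ∑ i, y i * ((∑ j, y j) - y i - ∑ j ∈ Finset.univ.erase i, x j) ^ 2
            / ((∑ j, y j) * (y i + ∑ j ∈ Finset.univ.erase i, x j) ^ 2) := by
  have hn' : (2 : ℝ) ≤ n := by exact_mod_cast hn
  have hn1 : (0 : ℝ) < (n : ℝ) - 1 := by linarith
  have hcard (i : Fin n) : ((univ.erase i).card : ℝ) = (n : ℝ) - 1 := by
    rw [card_erase_of_mem (mem_univ i), card_univ, Fintype.card_fin,
      Nat.cast_sub (by omega), Nat.cast_one]
  have hs_lower (i : Fin n) : ((n : ℝ) - 1) * xmin ≤ ∑ j ∈ univ.erase i, x j := by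
    have h := card_nsmul_le_sum (univ.erase i) x xmin fun j _ => (hx j).1
    rwa [nsmul_eq_mul, hcard] at h
  have hs_upper (i : Fin n) : ∑ j ∈ univ.erase i, x j ≤ (n : ℝ) - 1 := by
    have h := sum_le_card_nsmul (univ.erase i) x 1 fun j _ => (hx j).2
    rwa [nsmul_eq_mul, hcard, mul_one] at h
  have hσ_upper : ∑ j, y j ≤ n := by
    have h := sum_le_card_nsmul univ y 1 fun j _ => (hy j).2
    rwa [nsmul_eq_mul, card_univ, Fintype.card_fin, mul_one] at h
  have hσ_pos : 0 < ∑ j, y j :=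
    sum_pos (fun j _ => hxmin.trans_le (hy j).1) ⟨⟨0, by omega⟩, mem_univ _⟩
  have hdist : ∑ i, (y i - x i) ^ 2 ≤
      ∑ i, ((∑ j, y j) - y i - ∑ j ∈ univ.erase i, x j) ^ 2 := by
    refine (sum_sq_le_sum_sum_sub_sq hn fun i => y i - x i).trans_eq ?_
    refine sum_congr rfl fun i _ => ?_
    rw [sum_sub_distrib, ← add_sum_erase univ x (mem_univ i)]
    ring
  set s : Fin n → ℝ := fun i => ∑ j ∈ univ.erase i, x j
  set A := ∑ i, ((∑ j, y j) - y i - s i) ^ 2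
  have hquot : ∑ i, ((∑ j, y j) - y i - s i) ^ 2 / s i ^ 2 ≤
      A / (((n : ℝ) - 1) * xmin) ^ 2 := by
    rw [sum_div]
    gcongr with i
    exact hs_lower i
  have hregret : xmin / (n : ℝ) ^ 3 * A ≤
      ∑ i, y i * ((∑ j, y j) - y i - s i) ^ 2 / ((∑ j, y j) * (y i + s i) ^ 2) := by
    rw [mul_sum]
    refine sum_le_sum fun i _ => ?_
    have hyi := hxmin.trans_le (hy i).1
    have hsi : 0 < s i := (mul_pos hn1 hxmin).trans_le (hs_lower i)
    have hden : (∑ j, y j) * (y i + s i) ^ 2 ≤ (n : ℝ) ^ 3 := by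
      calc (∑ j, y j) * (y i + s i) ^ 2 ≤ n * (n : ℝ) ^ 2 := by
            gcongr
            have : s i ≤ (n : ℝ) - 1 := hs_upper i
            linarith [(hy i).2]
        _ = (n : ℝ) ^ 3 := by ring
    rw [div_mul_eq_mul_div]
    gcongr
    exact (hy i).1
  calc B2 / 2 * (∑ i, (y i - x i) ^ 2) + ∑ i, ((∑ j, y j) - y i - s i) ^ 2 / s i ^ 2
      ≤ B2 / 2 * A + A / (((n : ℝ) - 1) * xmin) ^ 2 := by gcongr
    _ = (B2 * (n : ℝ) ^ 3 / (2 * xmin) + (n : ℝ) ^ 3 / (((n : ℝ) - 1) ^ 2 * xmin ^ 3)) *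
          (xmin / (n : ℝ) ^ 3 * A) := by
        field_simp
    _ ≤ _ := by gcongr
end

section
/- Let β > 4 and define x = (β(β−2) − β√(β(β−4))) / (2(β−2)²) and y = (β(β−2) + β√(β(β−4))) / (2(β−2)²). Then x > 0, y > 0, x ≠ y, and the map φ(z) = β√z + (1−β)z satisfies φ(y) = x and φ(x) = y. -/
/-- For `t` a square root of `β(β−4)` of either sign, the candidate cycle point is the square of
`(β + t)/(2(β−2))`. -/
lemma sqrt_cycle_point {β t : ℝ} (hβ : 2 < β) (ht : t ^ 2 = β * (β - 4)) (hnonneg : 0 ≤ β + t) :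
    Real.sqrt ((β * (β - 2) + β * t) / (2 * (β - 2) ^ 2)) = (β + t) / (2 * (β - 2)) := by
  have hpos : 0 < β - 2 := sub_pos.2 hβ
  have hsq : (β * (β - 2) + β * t) / (2 * (β - 2) ^ 2) = ((β + t) / (2 * (β - 2))) ^ 2 := by
    field_simp
    linear_combination -ht
  rw [hsq, Real.sqrt_sq (by positivity)]

/-- The update map `z ↦ β√z + (1−β)z` sends the cycle point of `t` to that of `−t`. -/
lemma update_cycle_point {β t : ℝ} (hβ : 2 < β) (ht : t ^ 2 = β * (β - 4)) (hnonneg : 0 ≤ β + t) :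
    β * Real.sqrt ((β * (β - 2) + β * t) / (2 * (β - 2) ^ 2))
        + (1 - β) * ((β * (β - 2) + β * t) / (2 * (β - 2) ^ 2))
      = (β * (β - 2) - β * t) / (2 * (β - 2) ^ 2) := by
  have hne : β - 2 ≠ 0 := (sub_pos.2 hβ).ne'
  rw [sqrt_cycle_point hβ ht hnonneg]
  field_simp
  ring

/-- Two-cycle of discrete best-response dynamics in the symmetric lottery contest:
for every `β > 4`, the points `x = (β(β−2) − β√(β(β−4)))/(2(β−2)²)` and
`y = (β(β−2) + β√(β(β−4)))/(2(β−2)²)` are positive, distinct, and the update map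
`φ(z) = β√z + (1−β)z` satisfies `φ(y) = x` and `φ(x) = y`. -/
theorem symmetric_contest_two_cycle (β : ℝ) (hβ : 4 < β) :
    0 < (β * (β - 2) - β * Real.sqrt (β * (β - 4))) / (2 * (β - 2) ^ 2) ∧
      0 < (β * (β - 2) + β * Real.sqrt (β * (β - 4))) / (2 * (β - 2) ^ 2) ∧
      (β * (β - 2) - β * Real.sqrt (β * (β - 4))) / (2 * (β - 2) ^ 2) ≠
        (β * (β - 2) + β * Real.sqrt (β * (β - 4))) / (2 * (β - 2) ^ 2) ∧
      (β * Real.sqrt ((β * (β - 2) + β * Real.sqrt (β * (β - 4))) / (2 * (β - 2) ^ 2))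
          + (1 - β) * ((β * (β - 2) + β * Real.sqrt (β * (β - 4))) / (2 * (β - 2) ^ 2))
        = (β * (β - 2) - β * Real.sqrt (β * (β - 4))) / (2 * (β - 2) ^ 2)) ∧
      (β * Real.sqrt ((β * (β - 2) - β * Real.sqrt (β * (β - 4))) / (2 * (β - 2) ^ 2))
          + (1 - β) * ((β * (β - 2) - β * Real.sqrt (β * (β - 4))) / (2 * (β - 2) ^ 2))
        = (β * (β - 2) + β * Real.sqrt (β * (β - 4))) / (2 * (β - 2) ^ 2)) := by
  have hβ2 : 2 < β := by linarith
  have hpos : 0 < β := by linarith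
  have hden : 0 < 2 * (β - 2) ^ 2 := by nlinarith
  have hprod : 0 < β * (β - 4) := mul_pos hpos (sub_pos.2 hβ)
  have hs : Real.sqrt (β * (β - 4)) ^ 2 = β * (β - 4) := Real.sq_sqrt hprod.le
  have hs_pos : 0 < Real.sqrt (β * (β - 4)) := Real.sqrt_pos.2 hprod
  generalize Real.sqrt (β * (β - 4)) = s at hs hs_pos ⊢
  have hs_lt : s < β - 2 := by nlinarith
  have hβs : 0 < β * s := mul_pos hpos hs_pos
  have hlt : (β * (β - 2) - β * s) / (2 * (β - 2) ^ 2)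
      < (β * (β - 2) + β * s) / (2 * (β - 2) ^ 2) := by
    gcongr
    linarith
  have hx : 0 < (β * (β - 2) - β * s) / (2 * (β - 2) ^ 2) :=
    div_pos (by nlinarith) hden
  refine ⟨hx, hx.trans hlt, hlt.ne, update_cycle_point hβ2 hs (by linarith), ?_⟩
  simpa only [mul_neg, ← sub_eq_add_neg, sub_neg_eq_add] using
    update_cycle_point (t := -s) hβ2 (by rw [neg_sq, hs]) (by linarith)
end
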